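/- A Banach space X is crudely finitely representable in Y (i.e., λ-finitely representable for some λ > 1) if and only if X is isomorphic to a Banach space X₁ that is finitely representable in Y. -/

import Mathlib

/-- `X` is `l`-finitely representable in `Y`: every finite-dimensional subspace `A` of `X`
admits an isomorphism `u` onto a subspace `B` of `Y` with `‖u‖·‖u⁻¹‖ < l`. -/
def LambdaFinRep (l : ℝ) (X Y : Type*)
    [NormedAddCommGroup X] [NormedSpace ℝ X]
    [NormedAddCommGroup Y] [NormedSpace ℝ Y] : Prop :=
  ∀ A : Submodule ℝ X, FiniteDimensional ℝ A →
    ∃ (B : Submodule ℝ Y) (u : A ≃L[ℝ] B),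
      ‖(u : A →L[ℝ] B)‖ * ‖(u.symm : B →L[ℝ] A)‖ < l

/-- `X` is finitely representable in `Y` (`X <_f Y`). -/
def FinRep (X Y : Type*)
    [NormedAddCommGroup X] [NormedSpace ℝ X]
    [NormedAddCommGroup Y] [NormedSpace ℝ Y] : Prop :=
  ∀ l : ℝ, 1 < l → LambdaFinRep l X Y

open Filter Topology

/-- A linear embedding with two-sided bounds extracted from `LambdaFinRep`. -/
theorem LambdaFinRep.exists_map {l : ℝ} {X Y : Type*}
    [NormedAddCommGroup X] [NormedSpace ℝ X]
    [NormedAddCommGroup Y] [NormedSpace ℝ Y] (h : LambdaFinRep l X Y)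
    (A : Submodule ℝ X) (hA : FiniteDimensional ℝ A) :
    ∃ v : X →ₗ[ℝ] Y, ∀ x ∈ A, ‖x‖ ≤ ‖v x‖ ∧ ‖v x‖ ≤ l * ‖x‖ := by
  obtain ⟨B, u, hu⟩ := h A hA
  obtain ⟨v, hv⟩ := LinearMap.exists_extend
    (‖(u.symm : B →L[ℝ] A)‖ • (B.subtype ∘ₗ (u : A →L[ℝ] B).toLinearMap))
  refine ⟨v, fun x hx => ?_⟩
  have h1 : v x = ‖(u.symm : B →L[ℝ] A)‖ • ((u ⟨x, hx⟩ : B) : Y) := by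
    have := LinearMap.congr_fun hv ⟨x, hx⟩
    simpa using this
  have h2 : ‖v x‖ = ‖(u.symm : B →L[ℝ] A)‖ * ‖u ⟨x, hx⟩‖ := by
    rw [h1, norm_smul, Real.norm_of_nonneg (norm_nonneg (u.symm : B →L[ℝ] A)), Submodule.coe_norm]
  have h3 : ‖u ⟨x, hx⟩‖ ≤ ‖(u : A →L[ℝ] B)‖ * ‖x‖ :=
    (u : A →L[ℝ] B).le_opNorm ⟨x, hx⟩
  have h4 : ‖x‖ ≤ ‖(u.symm : B →L[ℝ] A)‖ * ‖u ⟨x, hx⟩‖ := by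
    have := (u.symm : B →L[ℝ] A).le_opNorm (u ⟨x, hx⟩)
    simpa using this
  refine ⟨h2 ▸ h4, ?_⟩
  rw [h2]
  calc _ ≤ ‖(u.symm : B →L[ℝ] A)‖ * (‖(u : A →L[ℝ] B)‖ * ‖x‖) := by gcongr
    _ = (‖(u : A →L[ℝ] B)‖ * ‖(u.symm : B →L[ℝ] A)‖) * ‖x‖ := by ring
    _ ≤ l * ‖x‖ := by gcongr

/-- Conversely a linear map with two-sided bounds on `A` gives an isomorphism onto its image. -/
theorem exists_equiv_of_bounds {X Y : Type*}
    [NormedAddCommGroup X] [NormedSpace ℝ X]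
    [NormedAddCommGroup Y] [NormedSpace ℝ Y]
    (A : Submodule ℝ X) (hA : FiniteDimensional ℝ A) (v : X →ₗ[ℝ] Y) {a b l : ℝ}
    (ha : 0 < a) (hb : 0 ≤ b) (hl : b * a⁻¹ < l)
    (hv : ∀ x ∈ A, a * ‖x‖ ≤ ‖v x‖ ∧ ‖v x‖ ≤ b * ‖x‖) :
    ∃ (B : Submodule ℝ Y) (u : A ≃L[ℝ] B),
      ‖(u : A →L[ℝ] B)‖ * ‖(u.symm : B →L[ℝ] A)‖ < l := by
  have hinj : Function.Injective (v ∘ₗ A.subtype) := by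
    rw [← LinearMap.ker_eq_bot, LinearMap.ker_eq_bot']
    intro x hx
    have h1 := (hv x x.2).1
    have h2 : v x = 0 := hx
    rw [h2, norm_zero] at h1
    have h3 : ‖(x : X)‖ ≤ 0 := by
      by_contra hc
      push Not at hc
      have := mul_pos ha hc
      linarith
    exact Subtype.ext (norm_le_zero_iff.1 h3)
  let u := (LinearEquiv.ofInjective (v ∘ₗ A.subtype) hinj).toContinuousLinearEquiv
  have hu : ∀ x : A, ‖u x‖ = ‖v x‖ := fun x => rfl
  refine ⟨_, u, lt_of_le_of_lt ?_ hl⟩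
  gcongr
  · exact ContinuousLinearMap.opNorm_le_bound _ hb fun x => (hv x x.2).2
  · refine ContinuousLinearMap.opNorm_le_bound _ (by positivity) fun y => ?_
    have h1 := (hv (u.symm y) (u.symm y).2).1
    rw [← hu, u.apply_symm_apply] at h1
    rw [inv_mul_eq_div, le_div_iff₀ ha, mul_comm]
    exact h1

/-- Maps whose norms converge pointwise to the norm, and are eventually uniformly bounded on
every finite-dimensional subspace, yield finite representability. -/
theorem finRep_of_tendsto {ι Z Y : Type*}
    [NormedAddCommGroup Z] [NormedSpace ℝ Z]
    [NormedAddCommGroup Y] [NormedSpace ℝ Y] (F : Filter ι) [F.NeBot]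
    (v : ι → Z →ₗ[ℝ] Y) {l : ℝ} (hl : 0 ≤ l)
    (hlim : ∀ z, Tendsto (fun i => ‖v i z‖) F (𝓝 ‖z‖))
    (hbd : ∀ E : Submodule ℝ Z, FiniteDimensional ℝ E →
      ∀ᶠ i in F, ∀ z ∈ E, ‖v i z‖ ≤ l * ‖z‖) : FinRep Z Y := by
  intro c hc E hE
  -- choose the tolerance
  obtain ⟨d, hd0, hd1, hdc⟩ : ∃ d : ℝ, 0 < d ∧ d < 1 ∧ (1 + d) * (1 - d)⁻¹ < c := by
    have hcont : ContinuousAt (fun d : ℝ => (1 + d) * (1 - d)⁻¹) 0 := by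
      refine ContinuousAt.mul (by fun_prop) (ContinuousAt.inv₀ (by fun_prop) (by norm_num))
    have h1 : ∀ᶠ d : ℝ in 𝓝 0, (1 + d) * (1 - d)⁻¹ < c :=
      hcont.eventually_lt_const (by simpa using hc)
    have h2 : ∀ᶠ d : ℝ in 𝓝 0, d < 1 := eventually_lt_nhds (by norm_num)
    have h3 : ∀ᶠ d : ℝ in 𝓝[>] 0, (1 + d) * (1 - d)⁻¹ < c ∧ d < 1 :=
      nhdsWithin_le_nhds (h1.and h2)
    obtain ⟨d, hd, hd0⟩ := (h3.and self_mem_nhdsWithin).exists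
    exact ⟨d, hd0, hd.2, hd.1⟩
  set r : ℝ := d / (l + 2) with hr
  have hr0 : 0 < r := by positivity
  have hrd : (l + 1) * r ≤ d := by
    rw [hr, mul_div_assoc', div_le_iff₀ (by positivity)]
    nlinarith
  have : ProperSpace E := FiniteDimensional.proper_real E
  obtain ⟨t, htS, htf, hcov⟩ := Metric.finite_approx_of_totallyBounded
      (isCompact_sphere (0 : E) 1).totallyBounded r hr0
  have hev : ∀ᶠ i in F, ∀ y ∈ t, |‖v i (y : Z)‖ - 1| < r := by
    rw [htf.eventually_all]
    intro y hy
    have hy1 : ‖(y : Z)‖ = 1 := by simpa using htS hy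
    have := hlim (y : Z)
    rw [hy1] at this
    simpa [Real.dist_eq] using (Metric.tendsto_nhds.1 this) r hr0
  obtain ⟨i, hi, hib⟩ := (hev.and (hbd E hE)).exists
  have hunit : ∀ x : E, ‖x‖ = 1 → |‖v i (x : Z)‖ - 1| ≤ d := by
    intro x hx
    have hxS : x ∈ Metric.sphere (0 : E) 1 := by simpa using hx
    obtain ⟨y, hy, hxy⟩ := Set.mem_iUnion₂.1 (hcov hxS)
    have h1 : ‖v i ((x - y : E) : Z)‖ ≤ l * ‖x - y‖ := hib _ (x - y).2
    rw [Metric.mem_ball, dist_eq_norm] at hxy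
    have h2 := abs_norm_sub_norm_le (v i (x : Z)) (v i (y : Z))
    rw [← map_sub, ← Submodule.coe_sub] at h2
    have h3 : l * ‖x - y‖ ≤ l * r := by gcongr
    have h4 := hi y hy
    rw [abs_le] at h2 ⊢
    rw [abs_lt] at h4
    constructor <;> linarith [h2.1, h2.2, h4.1, h4.2]
  refine exists_equiv_of_bounds E hE (v i) (a := 1 - d) (b := 1 + d) (by linarith) (by linarith)
    hdc fun x hx => ?_
  by_cases hx0 : x = 0
  · simp [hx0]
  have hn : 0 < ‖x‖ := norm_pos_iff.2 hx0
  have h1 := hunit (‖x‖⁻¹ • ⟨x, hx⟩) (by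
    rw [norm_smul, norm_inv, norm_norm]
    exact inv_mul_cancel₀ hn.ne')
  have h2 : ‖v i ((‖x‖⁻¹ • (⟨x, hx⟩ : E) : E) : Z)‖ = ‖v i x‖ / ‖x‖ := by
    rw [Submodule.coe_smul, map_smul, norm_smul, norm_inv, norm_norm, inv_mul_eq_div]
  rw [h2, abs_le] at h1
  constructor
  · rw [← le_div_iff₀ hn]; linarith [h1.1]
  · rw [← div_le_iff₀ hn]; linarith [h1.2]

/-- Type synonym carrying a new norm. -/
def RenormType (X : Type*) : Type _ := X

/-- Renorming with an equivalent norm. -/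
theorem exists_renorm {X : Type u} [NormedAddCommGroup X] [NormedSpace ℝ X] (N : Seminorm ℝ X)
    {l : ℝ} (h1 : ∀ x, ‖x‖ ≤ N x) (h2 : ∀ x, N x ≤ l * ‖x‖) :
    ∃ (X₁ : Type u) (_ : NormedAddCommGroup X₁) (_ : NormedSpace ℝ X₁) (e : X ≃L[ℝ] X₁),
      ∀ x, ‖e x‖ = N x := by
  let i0 : AddCommGroup (RenormType X) := inferInstanceAs (AddCommGroup X)
  let i0' : Module ℝ (RenormType X) := inferInstanceAs (Module ℝ X)
  let e0 : X ≃ₗ[ℝ] RenormType X := LinearEquiv.refl ℝ X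
  let i1 : NormedAddCommGroup (RenormType X) :=
    AddGroupNorm.toNormedAddCommGroup
      { toFun := fun x => N (e0.symm x)
        map_zero' := by simp
        add_le' := fun x y => by simpa using map_add_le_add N (e0.symm x) (e0.symm y)
        neg' := fun x => by simp
        eq_zero_of_map_eq_zero' := fun x hx => by
          have h3 := h1 (e0.symm x)
          have h4 : N (e0.symm x) = 0 := hx
          rw [h4] at h3
          simpa using h3 }
  have hnorm : ∀ x : RenormType X, ‖x‖ = N (e0.symm x) := fun x => rfl
  let i2 : NormedSpace ℝ (RenormType X) :=
    { i0' with
      norm_smul_le := fun c x => by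
        rw [hnorm, hnorm, map_smul, map_smul_eq_mul] }
  let e0' : X ≃ₗ[ℝ] RenormType X := LinearEquiv.refl ℝ X
  refine ⟨RenormType X, i1, i2, e0'.toContinuousLinearEquivOfBounds l 1 (fun x => h2 x)
    (fun x => ?_), fun x => rfl⟩
  rw [one_mul]
  exact h1 _

theorem crude_forward {X Y : Type u}
    [NormedAddCommGroup X] [NormedSpace ℝ X]
    [NormedAddCommGroup Y] [NormedSpace ℝ Y] {l : ℝ} (hl : 1 < l) (h : LambdaFinRep l X Y) :
      ∃ (X₁ : Type u) (_ : NormedAddCommGroup X₁) (_ : NormedSpace ℝ X₁),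
        Nonempty (X ≃L[ℝ] X₁) ∧ FinRep X₁ Y := by
  classical
  have hex : ∀ s : Finset X, ∃ v : X →ₗ[ℝ] Y, ∀ x ∈ Submodule.span ℝ (s : Set X),
      ‖x‖ ≤ ‖v x‖ ∧ ‖v x‖ ≤ l * ‖x‖ := fun s =>
    h.exists_map _ (FiniteDimensional.span_finset ℝ s)
  choose v hv using hex
  let F : Ultrafilter (Finset X) := Ultrafilter.of atTop
  have hF : (F : Filter (Finset X)) ≤ atTop := Ultrafilter.of_le _
  have hev : ∀ x, ∀ᶠ s in (F : Filter (Finset X)), ‖x‖ ≤ ‖v s x‖ ∧ ‖v s x‖ ≤ l * ‖x‖ := by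
    intro x
    refine hF ?_
    filter_upwards [eventually_ge_atTop {x}] with s hs
    exact hv s x (Submodule.subset_span (hs (by simp)))
  have hlim : ∀ x, ∃ a : ℝ, Tendsto (fun s => ‖v s x‖) F (𝓝 a) := by
    intro x
    obtain ⟨a, -, ha⟩ := (isCompact_Icc (a := ‖x‖) (b := l * ‖x‖)).ultrafilter_le_nhds
      (F.map fun s => ‖v s x‖) (by
        rw [le_principal_iff]
        exact hev x)
    exact ⟨a, ha⟩
  choose N hN using hlim
  let S : Seminorm ℝ X := Seminorm.of N
    (fun x y => le_of_tendsto_of_tendsto' (hN (x + y)) ((hN x).add (hN y)) fun s => by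
      rw [map_add]; exact norm_add_le _ _)
    (fun c x => tendsto_nhds_unique (hN (c • x)) (by
      simpa [norm_smul] using (hN x).const_mul ‖c‖))
  have hS1 : ∀ x, ‖x‖ ≤ S x := fun x => ge_of_tendsto (hN x) ((hev x).mono fun s hs => hs.1)
  have hS2 : ∀ x, S x ≤ l * ‖x‖ := fun x =>
    le_of_tendsto (hN x) ((hev x).mono fun s hs => hs.2)
  obtain ⟨X₁, i1, i2, e, he⟩ := exists_renorm S hS1 hS2
  refine ⟨X₁, i1, i2, ⟨e⟩, finRep_of_tendsto (F : Filter (Finset X))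
    (fun s => v s ∘ₗ (e.symm : X₁ →L[ℝ] X).toLinearMap) (l := l) (by linarith) ?_ ?_⟩
  · intro z
    have h1 : ‖z‖ = N (e.symm z) := by
      have := he (e.symm z)
      rw [e.apply_symm_apply] at this
      exact this
    rw [h1]
    exact hN (e.symm z)
  · intro E hE
    have hfg : (E.map (e.symm : X₁ →L[ℝ] X).toLinearMap).FG :=
      ((Submodule.fg_iff_finiteDimensional E).2 hE).map _
    obtain ⟨t, ht⟩ := hfg
    refine hF ?_
    filter_upwards [eventually_ge_atTop t] with s hs z hz
    have hmem : e.symm z ∈ Submodule.span ℝ (s : Set X) := by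
      refine Submodule.span_mono (Finset.coe_subset.2 hs) ?_
      rw [ht]
      exact ⟨z, hz, rfl⟩
    refine (hv s _ hmem).2.trans ?_
    have := hS1 (e.symm z)
    rw [← he, e.apply_symm_apply] at this
    gcongr

theorem crude_backward {X Y X₁ : Type*}
    [NormedAddCommGroup X] [NormedSpace ℝ X]
    [NormedAddCommGroup Y] [NormedSpace ℝ Y] [NormedAddCommGroup X₁] [NormedSpace ℝ X₁]
    (e : X ≃L[ℝ] X₁) (h : FinRep X₁ Y) : ∃ l : ℝ, 1 < l ∧ LambdaFinRep l X Y := by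
  set p := ‖(e : X →L[ℝ] X₁)‖ with hp
  set q := ‖(e.symm : X₁ →L[ℝ] X)‖ with hq
  have hp0 : 0 ≤ p := norm_nonneg _
  have hq0 : 0 ≤ q := norm_nonneg _
  have hpq : 0 ≤ p * q := by positivity
  refine ⟨2 * p * (q + 1) + 2, by nlinarith, fun A hA => ?_⟩
  obtain ⟨v, hv⟩ := (h 2 (by norm_num)).exists_map (A.map (e : X →L[ℝ] X₁).toLinearMap)
    inferInstance
  refine exists_equiv_of_bounds A hA (v ∘ₗ (e : X →L[ℝ] X₁).toLinearMap) (a := (q + 1)⁻¹)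
    (b := 2 * p) (by positivity) (by positivity) (by rw [inv_inv]; linarith) fun x hx => ?_
  obtain ⟨h1, h2⟩ := hv (e x) ⟨x, hx, rfl⟩
  have h3 : ‖e x‖ ≤ p * ‖x‖ := (e : X →L[ℝ] X₁).le_opNorm x
  have h4 : ‖x‖ ≤ q * ‖e x‖ := by
    have := (e.symm : X₁ →L[ℝ] X).le_opNorm (e x)
    simpa using this
  constructor
  · refine le_trans ?_ h1
    rw [inv_mul_eq_div, div_le_iff₀ (by positivity)]
    nlinarith [norm_nonneg (e x)]
  · refine h2.trans ?_
    linarith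

/-- `X` is crudely finitely representable in `Y` (i.e. `l`-finitely representable for some
`l > 1`) if and only if `X` is isomorphic to a Banach space `X₁` that is finitely
representable in `Y`. -/
theorem crudeFinRep_iff_iso_finRep {X Y : Type u}
    [NormedAddCommGroup X] [NormedSpace ℝ X] [CompleteSpace X]
    [NormedAddCommGroup Y] [NormedSpace ℝ Y] [CompleteSpace Y] :
    (∃ l : ℝ, 1 < l ∧ LambdaFinRep l X Y) ↔
      ∃ (X₁ : Type u) (_ : NormedAddCommGroup X₁) (_ : NormedSpace ℝ X₁),
        Nonempty (X ≃L[ℝ] X₁) ∧ FinRep X₁ Y := by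
  constructor
  · rintro ⟨l, hl, h⟩
    exact crude_forward hl h
  · rintro ⟨X₁, i1, i2, ⟨e⟩, h⟩
    exact crude_backward e h
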